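/- arXiv:math/0409477 — 7 statements merged into one kernel-verified Lean document; each statement's English description precedes it below -/
import Mathlib

section
/- For an object a of a regular Q-semicategory A, the following are equivalent: (1) a is stable; (2) there exists an idempotent Q-arrow e : ta → ta such that e ≤ A(a,a) and, for all a' ∈ A₀, A(a',a)∘e = A(a',a) and e∘A(a,a') = A(a,a'); (3) for all a' ∈ A₀, A(a',a)∘A(a,a) = A(a',a) and A(a,a)∘A(a,a') = A(a,a'). -/
open CategoryTheory

universe u

variable (Q : Type u) [SmallCategory Q] [∀ X Y : Q, CompleteLattice (X ⟶ Y)]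

/-- A (small) quantaloid: a category whose hom-sets are complete lattices and in which
composition distributes on both sides over arbitrary suprema. -/
class IsQuantaloid : Prop where
  comp_sSup : ∀ {X Y Z : Q} (f : X ⟶ Y) (S : Set (Y ⟶ Z)),
      f ≫ sSup S = ⨆ g ∈ S, f ≫ g
  sSup_comp : ∀ {X Y Z : Q} (S : Set (X ⟶ Y)) (g : Y ⟶ Z),
      sSup S ≫ g = ⨆ f ∈ S, f ≫ g

/-- A `Q`-typed set together with a matrix of hom-arrows.  `A.hom a a' : A.ty a ⟶ A.ty a'`
is the hom-arrow written `A(a',a) : ta → ta'` in the paper. -/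
structure QGraph where
  Obj : Type u
  ty : Obj → Q
  hom : ∀ a a' : Obj, ty a ⟶ ty a'

variable {Q}

namespace QGraph

/-- `Q`-semicategory: composition inequality. -/
def IsSemiCat (A : QGraph Q) : Prop :=
  ∀ a a' a'' : A.Obj, A.hom a a' ≫ A.hom a' a'' ≤ A.hom a a''

/-- Regular `Q`-semicategory. -/
def IsRegular (A : QGraph Q) : Prop :=
  A.IsSemiCat ∧ ∀ a a'' : A.Obj, (⨆ a' : A.Obj, A.hom a a' ≫ A.hom a' a'') = A.hom a a''

/-- Totally regular `Q`-semicategory (elementary characterization):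
`A(a,a)∘A(a,a') = A(a,a')` and `A(a',a)∘A(a,a) = A(a',a)`. -/
def IsTR (A : QGraph Q) : Prop :=
  A.IsSemiCat ∧ (∀ a a' : A.Obj, A.hom a a ≫ A.hom a a' = A.hom a a')
    ∧ (∀ a a' : A.Obj, A.hom a' a ≫ A.hom a a = A.hom a' a)

/-- `Q`-category: composition inequality plus unit inequality. -/
def IsCat (A : QGraph Q) : Prop :=
  A.IsSemiCat ∧ ∀ a : A.Obj, 𝟙 (A.ty a) ≤ A.hom a a

/-- Normal `Q`-category: all endo-hom-arrows are identities. -/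
def IsNormal (A : QGraph Q) : Prop :=
  ∀ a : A.Obj, A.hom a a = 𝟙 (A.ty a)

/-- The one-object structure `*_e` on an arrow `e : X ⟶ X`. -/
def single (X : Q) (e : X ⟶ X) : QGraph Q :=
  ⟨PUnit, fun _ => X, fun _ _ => e⟩

/-- Full subgraph determined by a subset of the objects. -/
def restrict (A : QGraph Q) (s : Set A.Obj) : QGraph Q :=
  ⟨s, fun x => A.ty x, fun x y => A.hom x y⟩

end QGraph

/-- A matrix of `Q`-arrows: `Φ a b : ty a ⟶ ty b` is the paper's `Φ(b,a) : ta → tb`. -/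
def QMat (A B : QGraph Q) : Type u :=
  ∀ (a : A.Obj) (b : B.Obj), A.ty a ⟶ B.ty b

/-- Composition of matrices: `(Ψ⊗Φ)(c,a) = ⋁_b Ψ(c,b)∘Φ(b,a)`. -/
def matComp {A B C : QGraph Q} (Φ : QMat A B) (Ψ : QMat B C) : QMat A C :=
  fun a c => ⨆ b, Φ a b ≫ Ψ b c

/-- (Plain) distributor between `Q`-categories. -/
def IsDist {A B : QGraph Q} (Φ : QMat A B) : Prop :=
  (∀ (a : A.Obj) (b b' : B.Obj), Φ a b ≫ B.hom b b' ≤ Φ a b') ∧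
  (∀ (a' a : A.Obj) (b : B.Obj), A.hom a' a ≫ Φ a b ≤ Φ a' b)

/-- Regular semidistributor. -/
def IsRSDist {A B : QGraph Q} (Φ : QMat A B) : Prop :=
  (∀ (a : A.Obj) (b' : B.Obj), (⨆ b, Φ a b ≫ B.hom b b') = Φ a b') ∧
  (∀ (a' : A.Obj) (b : B.Obj), (⨆ a, A.hom a' a ≫ Φ a b) = Φ a' b)

/-- Adjunction `Φ ⊣ Ψ` (unit and counit inequalities) between matrices. -/
def MatAdj {A B : QGraph Q} (Φ : QMat A B) (Ψ : QMat B A) : Prop :=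
  (∀ a a', A.hom a a' ≤ matComp Φ Ψ a a') ∧
  (∀ b b', matComp Ψ Φ b b' ≤ B.hom b b')

/-- A type-preserving object map. -/
structure ObjMap (A B : QGraph Q) where
  map : A.Obj → B.Obj
  ty_eq : ∀ a, B.ty (map a) = A.ty a

namespace ObjMap

variable {A B C : QGraph Q}

/-- The matrix `B(-,F-)` induced by an object map. -/
def graph (F : ObjMap A B) : QMat A B :=
  fun a b => eqToHom (F.ty_eq a).symm ≫ B.hom (F.map a) b

/-- The matrix `B(F-,-)` induced by an object map. -/
def cograph (F : ObjMap A B) : QMat B A :=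
  fun b a => B.hom b (F.map a) ≫ eqToHom (F.ty_eq a)

/-- Semifunctor: `A(a',a) ≤ B(Fa',Fa)`. -/
def IsSemiFun (F : ObjMap A B) : Prop :=
  ∀ a a', A.hom a a' ≤
    eqToHom (F.ty_eq a).symm ≫ B.hom (F.map a) (F.map a') ≫ eqToHom (F.ty_eq a')

/-- Fully faithful semifunctor: `A(a',a) = B(Fa',Fa)`. -/
def IsFullyFaithful (F : ObjMap A B) : Prop :=
  ∀ a a', A.hom a a' =
    eqToHom (F.ty_eq a).symm ≫ B.hom (F.map a) (F.map a') ≫ eqToHom (F.ty_eq a')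

/-- Regular semifunctor: a semifunctor such that `⋁_{a'} B(b,Fa')∘A(a',a) = B(b,Fa)` and
`⋁_{a'} A(a,a')∘B(Fa',b) = B(Fa,b)`. -/
def IsRSFun (F : ObjMap A B) : Prop :=
  F.IsSemiFun ∧
  (∀ a b, (⨆ a', A.hom a a' ≫ F.graph a' b) = F.graph a b) ∧
  (∀ a b, (⨆ a', F.cograph b a' ≫ A.hom a' a) = F.cograph b a)

/-- Composition of object maps (`G ∘ F`). -/
def comp (F : ObjMap A B) (G : ObjMap B C) : ObjMap A C :=
  ⟨fun a => G.map (F.map a), fun a => (G.ty_eq (F.map a)).trans (F.ty_eq a)⟩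

end ObjMap

/-- A left adjoint matrix `Φ` (with right adjoint `Ψ`) converges when it is induced by a
regular semifunctor, i.e. `Φ = B(-,F-)` and `Ψ = B(F-,-)`. -/
def Converges {A B : QGraph Q} (Φ : QMat A B) (Ψ : QMat B A) : Prop :=
  ∃ F : ObjMap A B, F.IsRSFun ∧ (∀ a b, Φ a b = F.graph a b) ∧ (∀ b a, Ψ b a = F.cograph b a)

/-- Cauchy completeness of a totally regular `Q`-semicategory:
every Cauchy (left adjoint) regular semidistributor into it converges. -/
def CauchyComplete (B : QGraph Q) : Prop :=
  ∀ (A : QGraph Q), A.IsTR → ∀ (Φ : QMat A B) (Ψ : QMat B A),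
    IsRSDist Φ → IsRSDist Ψ → MatAdj Φ Ψ → Converges Φ Ψ

/-- Cauchy completeness of a `Q`-category: every left adjoint distributor into it
is induced by a functor. -/
def CatCauchyComplete (B : QGraph Q) : Prop :=
  ∀ (A : QGraph Q), A.IsCat → ∀ (Φ : QMat A B) (Ψ : QMat B A),
    IsDist Φ → IsDist Ψ → MatAdj Φ Ψ →
    ∃ F : ObjMap A B, F.IsSemiFun ∧ ∀ a b, Φ a b = F.graph a b

/-- An object `a` of a regular `Q`-semicategory is stable when it is the value of a regular
semifunctor on a one-object regular `Q`-semicategory `*_e` (`e` an idempotent). -/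
def QGraph.Stable (A : QGraph Q) (a : A.Obj) : Prop :=
  ∃ (X : Q) (e : X ⟶ X), e ≫ e = e ∧
    ∃ F : ObjMap (QGraph.single X e) A, F.IsRSFun ∧ F.map PUnit.unit = a

theorem comp_mono_left_of_quantaloid [IsQuantaloid Q] {X Y Z : Q} {f g : X ⟶ Y} (h : f ≤ g)
    (k : Y ⟶ Z) : f ≫ k ≤ g ≫ k := by
  have := IsQuantaloid.sSup_comp {f, g} k
  rw [sSup_pair, sup_eq_right.2 h, iSup_pair] at this
  exact this ▸ le_sup_left

theorem comp_mono_right_of_quantaloid [IsQuantaloid Q] {X Y Z : Q} (k : X ⟶ Y) {f g : Y ⟶ Z}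
    (h : f ≤ g) : k ≫ f ≤ k ≫ g := by
  have := IsQuantaloid.comp_sSup k {f, g}
  rw [sSup_pair, sup_eq_right.2 h, iSup_pair] at this
  exact this ▸ le_sup_left

theorem QGraph.stable_iff_exists_idem (A : QGraph Q) (a : A.Obj) :
    A.Stable a ↔
      ∃ e : A.ty a ⟶ A.ty a, e ≫ e = e ∧ e ≤ A.hom a a ∧
        (∀ a', e ≫ A.hom a a' = A.hom a a') ∧
        (∀ a', A.hom a' a ≫ e = A.hom a' a) := by
  constructor
  · rintro ⟨X, e, he, F, hF, hFa⟩
    obtain rfl : A.ty a = X := hFa ▸ F.ty_eq PUnit.unit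
    obtain ⟨f, hf⟩ := F
    obtain rfl : f = fun _ => a := funext fun _ => hFa
    obtain ⟨h1, h2, h3⟩ := hF
    refine ⟨e, he, ?_, fun a' => ?_, fun a' => ?_⟩
    · exact (h1 PUnit.unit PUnit.unit).trans_eq
        ((Category.id_comp _).trans (Category.comp_id _))
    · have h := (iSup_unique (ι := PUnit) _).symm.trans (h2 PUnit.unit a')
      exact (congrArg (e ≫ ·) (Category.id_comp _)).symm.trans
        (h.trans (Category.id_comp _))
    · have h := (iSup_unique (ι := PUnit) _).symm.trans (h3 PUnit.unit a')
      exact (congrArg (· ≫ e) (Category.comp_id _)).symm.trans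
        (h.trans (Category.comp_id _))
  · rintro ⟨e, he, hle, h1, h2⟩
    refine ⟨A.ty a, e, he, ⟨fun _ => a, fun _ => rfl⟩,
      ⟨fun _ _ => ?_, fun _ a' => ?_, fun _ a' => ?_⟩, rfl⟩
    · exact hle.trans_eq ((Category.id_comp _).trans (Category.comp_id _)).symm
    · refine (iSup_unique (ι := PUnit) _).trans ?_
      exact (congrArg (e ≫ ·) (Category.id_comp _)).trans
        ((h1 a').trans (Category.id_comp _).symm)
    · refine (iSup_unique (ι := PUnit) _).trans ?_
      exact (congrArg (· ≫ e) (Category.comp_id _)).trans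
        ((h2 a').trans (Category.comp_id _).symm)

theorem QGraph.IsSemiCat.exists_idem_iff_endo_identity [IsQuantaloid Q] {A : QGraph Q}
    (hA : A.IsSemiCat) (a : A.Obj) :
    (∃ e : A.ty a ⟶ A.ty a, e ≫ e = e ∧ e ≤ A.hom a a ∧
        (∀ a', e ≫ A.hom a a' = A.hom a a') ∧
        (∀ a', A.hom a' a ≫ e = A.hom a' a)) ↔
      ∀ a', A.hom a a ≫ A.hom a a' = A.hom a a' ∧
        A.hom a' a ≫ A.hom a a = A.hom a' a := by
  constructor
  · rintro ⟨e, -, hle, h1, h2⟩ a'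
    exact ⟨(hA _ _ _).antisymm
        ((h1 a').symm.trans_le (comp_mono_left_of_quantaloid hle _)),
      (hA _ _ _).antisymm
        ((h2 a').symm.trans_le (comp_mono_right_of_quantaloid _ hle))⟩
  · exact fun h => ⟨A.hom a a, (h a).1, le_rfl, fun a' => (h a').1, fun a' => (h a').2⟩

/-- for an object `a` of a regular `Q`-semicategory `A`, stability is
equivalent to the existence of an idempotent `e ≤ A(a,a)` acting as identity at `a`,
and to `A(a,a)` itself acting as identity at `a`. -/
theorem stable_iff_idem_iff_endo_identity [IsQuantaloid Q]
    (A : QGraph Q) (hA : A.IsRegular) (a : A.Obj) :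
    (A.Stable a ↔
      ∃ e : A.ty a ⟶ A.ty a, e ≫ e = e ∧ e ≤ A.hom a a ∧
        (∀ a', e ≫ A.hom a a' = A.hom a a') ∧
        (∀ a', A.hom a' a ≫ e = A.hom a' a)) ∧
    (A.Stable a ↔
      ∀ a', A.hom a a ≫ A.hom a a' = A.hom a a' ∧
        A.hom a' a ≫ A.hom a a = A.hom a' a) := by
  exact ⟨A.stable_iff_exists_idem a,
    (A.stable_iff_exists_idem a).trans (hA.1.exists_idem_iff_endo_identity a)⟩
end

section
/- A Q-typed set A₀ together with Q-arrows A(a',a) : ta → ta' satisfying, for all a,a',a'' ∈ A₀, the composition inequality A(a'',a')∘A(a',a) ≤ A(a'',a) together with the equations A(a,a)∘A(a,a') = A(a,a') and A(a',a)∘A(a,a) = A(a',a), is automatically a regular Q-semicategory all of whose objects are stable (i.e. a totally regular Q-semicategory); conversely, every totally regular Q-semicategory satisfies these (in)equations. -/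
open CategoryTheory

universe u

variable (Q : Type u) [SmallCategory Q] [∀ X Y : Q, CompleteLattice (X ⟶ Y)]

variable {Q}

section Monotonicity

variable {X Y Z : Q}

theorem IsQuantaloid.comp_mono_right [IsQuantaloid Q] (f : X ⟶ Y) {g g' : Y ⟶ Z}
    (h : g ≤ g') : f ≫ g ≤ f ≫ g' := by
  have hs := IsQuantaloid.comp_sSup f {g, g'}
  rw [sSup_pair, sup_eq_right.mpr h, iSup_pair] at hs
  exact hs ▸ le_sup_left

theorem IsQuantaloid.comp_mono_left [IsQuantaloid Q] {f f' : X ⟶ Y} (g : Y ⟶ Z)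
    (h : f ≤ f') : f ≫ g ≤ f' ≫ g := by
  have hs := IsQuantaloid.sSup_comp {f, f'} g
  rw [sSup_pair, sup_eq_right.mpr h, iSup_pair] at hs
  exact hs ▸ le_sup_left

end Monotonicity

namespace QGraph

theorem isRegular_of_local_identity {A : QGraph Q} (hA : A.IsSemiCat)
    (hl : ∀ a a' : A.Obj, A.hom a a ≫ A.hom a a' = A.hom a a') : A.IsRegular :=
  ⟨hA, fun a a'' => le_antisymm (iSup_le fun a' => hA a a' a'')
    (le_iSup_of_le a (hl a a'').ge)⟩

theorem stable_of_local_identity {A : QGraph Q} {a : A.Obj}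
    (hl : ∀ a' : A.Obj, A.hom a a ≫ A.hom a a' = A.hom a a')
    (hr : ∀ a' : A.Obj, A.hom a' a ≫ A.hom a a = A.hom a' a) : A.Stable a := by
  refine ⟨A.ty a, A.hom a a, hl a, ⟨fun _ => a, fun _ => rfl⟩, ⟨?_, ?_, ?_⟩, rfl⟩
  · rintro ⟨⟩ ⟨⟩
    exact ((Category.id_comp _).trans (Category.comp_id _)).ge
  · rintro ⟨⟩ b
    refine (iSup_const (ι := PUnit) (a := A.hom a a ≫ 𝟙 (A.ty a) ≫ A.hom a b)).trans ?_
    refine (congrArg (A.hom a a ≫ ·) (Category.id_comp (A.hom a b))).trans ?_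
    exact (hl b).trans (Category.id_comp _).symm
  · rintro ⟨⟩ b
    refine (iSup_const (ι := PUnit) (a := (A.hom b a ≫ 𝟙 (A.ty a)) ≫ A.hom a a)).trans ?_
    refine (congrArg (· ≫ A.hom a a) (Category.comp_id (A.hom b a))).trans ?_
    exact (hr b).trans (Category.comp_id _).symm

/-- A regular semifunctor `*_e → A` with value `a` exhibits `e`, up to the identification of types,
as an arrow below `A(a,a)` acting as a two-sided identity on all adjacent hom-arrows. -/
theorem exists_le_hom_of_isRSFun {A : QGraph Q} {a : A.Obj} {X : Q} {e : X ⟶ X}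
    (h : A.ty a = X)
    (hF : (ObjMap.mk (fun _ => a) (fun _ => h) : ObjMap (single X e) A).IsRSFun) :
    ∃ e : A.ty a ⟶ A.ty a, e ≤ A.hom a a ∧ (∀ b, e ≫ A.hom a b = A.hom a b) ∧
      ∀ b, A.hom b a ≫ e = A.hom b a := by
  subst h
  obtain ⟨hF, hl, hr⟩ := hF
  refine ⟨e, ?_, fun b => ?_, fun b => ?_⟩
  · exact (hF PUnit.unit PUnit.unit).trans
      ((Category.id_comp _).trans (Category.comp_id _)).le
  · have h := (iSup_const (ι := PUnit) (a := e ≫ 𝟙 (A.ty a) ≫ A.hom a b)).symm.trans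
      (hl PUnit.unit b)
    exact (congrArg (e ≫ ·) (Category.id_comp (A.hom a b))).symm.trans
      (h.trans (Category.id_comp _))
  · have h := (iSup_const (ι := PUnit) (a := (A.hom b a ≫ 𝟙 (A.ty a)) ≫ e)).symm.trans
      (hr PUnit.unit b)
    exact (congrArg (· ≫ e) (Category.comp_id (A.hom b a))).symm.trans
      (h.trans (Category.comp_id _))

theorem Stable.exists_le_hom {A : QGraph Q} {a : A.Obj} (ha : A.Stable a) :
    ∃ e : A.ty a ⟶ A.ty a, e ≤ A.hom a a ∧ (∀ b, e ≫ A.hom a b = A.hom a b) ∧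
      ∀ b, A.hom b a ≫ e = A.hom b a := by
  obtain ⟨X, e, -, F, hF, rfl⟩ := ha
  exact exists_le_hom_of_isRSFun (F.ty_eq PUnit.unit) hF

theorem Stable.hom_comp_hom [IsQuantaloid Q] {A : QGraph Q} (hA : A.IsSemiCat) {a : A.Obj}
    (ha : A.Stable a) (b : A.Obj) : A.hom a a ≫ A.hom a b = A.hom a b := by
  obtain ⟨e, he, hl, -⟩ := ha.exists_le_hom
  exact le_antisymm (hA a a b)
    ((hl b).ge.trans (IsQuantaloid.comp_mono_left (A.hom a b) he))

theorem Stable.hom_comp_hom_self [IsQuantaloid Q] {A : QGraph Q} (hA : A.IsSemiCat) {a : A.Obj}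
    (ha : A.Stable a) (b : A.Obj) : A.hom b a ≫ A.hom a a = A.hom b a := by
  obtain ⟨e, he, -, hr⟩ := ha.exists_le_hom
  exact le_antisymm (hA b a a)
    ((hr b).ge.trans (IsQuantaloid.comp_mono_right (A.hom b a) he))

end QGraph

/-- a `Q`-semicategory whose hom-arrows satisfy the two local-identity
equations is automatically a regular `Q`-semicategory all of whose objects are stable
(a totally regular `Q`-semicategory), and conversely. -/
theorem totally_regular_elementary_characterization [IsQuantaloid Q]
    (A : QGraph Q) (hA : A.IsSemiCat) :
    ((∀ a a' : A.Obj, A.hom a a ≫ A.hom a a' = A.hom a a') ∧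
     (∀ a a' : A.Obj, A.hom a' a ≫ A.hom a a = A.hom a' a)) ↔
    (A.IsRegular ∧ ∀ a : A.Obj, A.Stable a) := by
  constructor
  · rintro ⟨hl, hr⟩
    exact ⟨QGraph.isRegular_of_local_identity hA hl,
      fun a => QGraph.stable_of_local_identity (hl a) (hr a)⟩
  · rintro ⟨-, hs⟩
    exact ⟨fun a => (hs a).hom_comp_hom hA, fun a => (hs a).hom_comp_hom_self hA⟩
end

section
/- Let A and B be totally regular Q-semicategories. A matrix of Q-arrows Φ(b,a) : ta → tb (one for each (a,b) ∈ A₀×B₀) is a regular semidistributor Φ : A ⇸ B if and only if it satisfies, for all a,a' ∈ A₀ and b,b' ∈ B₀: B(b',b)∘Φ(b,a) ≤ Φ(b',a), Φ(b,a)∘A(a,a') ≤ Φ(b,a'), B(b,b)∘Φ(b,a) = Φ(b,a) and Φ(b,a)∘A(a,a) = Φ(b,a). -/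
open CategoryTheory

universe u

variable (Q : Type u) [SmallCategory Q] [∀ X Y : Q, CompleteLattice (X ⟶ Y)]

variable {Q}

section Suprema

variable [IsQuantaloid Q]

theorem iSup_comp_quantaloid {ι : Sort*} {X Y Z : Q} (f : ι → (X ⟶ Y)) (g : Y ⟶ Z) :
    (⨆ i, f i) ≫ g = ⨆ i, f i ≫ g := by
  rw [iSup, IsQuantaloid.sSup_comp, iSup_range]

theorem comp_iSup_quantaloid {ι : Sort*} {X Y Z : Q} (f : X ⟶ Y) (g : ι → (Y ⟶ Z)) :
    f ≫ (⨆ i, g i) = ⨆ i, f ≫ g i := by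
  rw [iSup, IsQuantaloid.comp_sSup, iSup_range]

end Suprema

/-- elementary characterization of regular semidistributors between
totally regular `Q`-semicategories. -/
theorem isRSDist_iff_elementary [IsQuantaloid Q]
    (A B : QGraph Q) (hA : A.IsTR) (hB : B.IsTR) (Φ : QMat A B) :
    IsRSDist Φ ↔
      ((∀ a b b', Φ a b ≫ B.hom b b' ≤ Φ a b') ∧
       (∀ a' a b, A.hom a' a ≫ Φ a b ≤ Φ a' b) ∧
       (∀ a b, Φ a b ≫ B.hom b b = Φ a b) ∧
       (∀ a b, A.hom a a ≫ Φ a b = Φ a b)) := by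
  constructor
  · rintro ⟨hr, hl⟩
    refine ⟨fun a b b' => ?_, fun a' a b => ?_, fun a b => ?_, fun a b => ?_⟩
    · exact (le_iSup (fun b => Φ a b ≫ B.hom b b') b).trans_eq (hr a b')
    · exact (le_iSup (fun a => A.hom a' a ≫ Φ a b) a).trans_eq (hl a' b)
    · rw [← hr a b, iSup_comp_quantaloid]
      simp only [Category.assoc, hB.2.2]
    · rw [← hl a b, comp_iSup_quantaloid]
      simp only [← Category.assoc, hA.2.1]
  · rintro ⟨hr, hl, hr', hl'⟩
    refine ⟨fun a b' => le_antisymm (iSup_le fun b => hr a b b') ?_,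
      fun a' b => le_antisymm (iSup_le fun a => hl a' a b) ?_⟩
    · exact (hr' a b').symm.trans_le (le_iSup (fun b => Φ a b ≫ B.hom b b') b')
    · exact (hl' a' b).symm.trans_le (le_iSup (fun a => A.hom a' a ≫ Φ a b) a')
end

section
/- Let A and B be totally regular Q-semicategories. A type-preserving object map F : A₀ → B₀ is a regular semifunctor F : A → B if and only if it satisfies, for all a,a' ∈ A₀ and b ∈ B₀: A(a',a) ≤ B(Fa',Fa), B(b,Fa)∘A(a,a) = B(b,Fa) and A(a,a)∘B(Fa,b) = B(Fa,b). -/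
open CategoryTheory

universe u

variable (Q : Type u) [SmallCategory Q] [∀ X Y : Q, CompleteLattice (X ⟶ Y)]

variable {Q}

theorem comp_iSup_of_isQuantaloid [IsQuantaloid Q] {ι : Sort*} {X Y Z : Q} (f : X ⟶ Y)
    (g : ι → (Y ⟶ Z)) : f ≫ (⨆ i, g i) = ⨆ i, f ≫ g i := by
  rw [iSup, IsQuantaloid.comp_sSup, iSup_range]

theorem iSup_comp_of_isQuantaloid [IsQuantaloid Q] {ι : Sort*} {X Y Z : Q} (f : ι → (X ⟶ Y))
    (g : Y ⟶ Z) : (⨆ i, f i) ≫ g = ⨆ i, f i ≫ g := by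
  rw [iSup, IsQuantaloid.sSup_comp, iSup_range]

theorem comp_le_comp_of_isQuantaloid [IsQuantaloid Q] {X Y Z : Q} {f f' : X ⟶ Y} {g g' : Y ⟶ Z}
    (hf : f ≤ f') (hg : g ≤ g') : f ≫ g ≤ f' ≫ g' := by
  have left : f ≫ g ≤ f' ≫ g := by
    have h := IsQuantaloid.sSup_comp {f, f'} g
    rw [sSup_pair, sup_eq_right.mpr hf] at h
    rw [h]
    exact le_iSup₂_of_le f (by simp) le_rfl
  have right : f' ≫ g ≤ f' ≫ g' := by
    have h := IsQuantaloid.comp_sSup f' {g, g'}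
    rw [sSup_pair, sup_eq_right.mpr hg] at h
    rw [h]
    exact le_iSup₂_of_le g (by simp) le_rfl
  exact left.trans right

namespace ObjMap

/-- The matrix `B(-,F-)` of a semifunctor is stable under the action of its domain. -/
theorem IsSemiFun.hom_comp_graph_le [IsQuantaloid Q] {A B : QGraph Q} {F : ObjMap A B}
    (hF : F.IsSemiFun) (hB : B.IsSemiCat) (a a' : A.Obj) (b : B.Obj) :
    A.hom a a' ≫ F.graph a' b ≤ F.graph a b := by
  refine (comp_le_comp_of_isQuantaloid (hF a a') le_rfl).trans ?_
  simpa [graph] using comp_le_comp_of_isQuantaloid (le_refl (eqToHom (F.ty_eq a).symm))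
    (hB (F.map a) (F.map a') b)

/-- The matrix `B(F-,-)` of a semifunctor is stable under the action of its domain. -/
theorem IsSemiFun.cograph_comp_hom_le [IsQuantaloid Q] {A B : QGraph Q} {F : ObjMap A B}
    (hF : F.IsSemiFun) (hB : B.IsSemiCat) (a a' : A.Obj) (b : B.Obj) :
    F.cograph b a' ≫ A.hom a' a ≤ F.cograph b a := by
  refine (comp_le_comp_of_isQuantaloid le_rfl (hF a' a)).trans ?_
  simpa [cograph] using comp_le_comp_of_isQuantaloid (hB b (F.map a') (F.map a))
    (le_refl (eqToHom (F.ty_eq a)))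

end ObjMap

/-- elementary characterization of regular semifunctors between
totally regular `Q`-semicategories. -/
theorem isRSFun_iff_elementary [IsQuantaloid Q]
    (A B : QGraph Q) (hA : A.IsTR) (hB : B.IsTR) (F : ObjMap A B) :
    F.IsRSFun ↔
      (F.IsSemiFun ∧
       (∀ a b, A.hom a a ≫ F.graph a b = F.graph a b) ∧
       (∀ a b, F.cograph b a ≫ A.hom a a = F.cograph b a)) := by
  constructor
  · rintro ⟨hF, hgraph, hcograph⟩
    refine ⟨hF, fun a b => ?_, fun a b => ?_⟩
    · rw [← hgraph a b, comp_iSup_of_isQuantaloid]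
      exact iSup_congr fun a' => by rw [← Category.assoc, hA.2.1]
    · rw [← hcograph a b, iSup_comp_of_isQuantaloid]
      exact iSup_congr fun a' => by rw [Category.assoc, hA.2.2]
  · rintro ⟨hF, hgraph, hcograph⟩
    refine ⟨hF, fun a b => le_antisymm ?_ ?_, fun a b => le_antisymm ?_ ?_⟩
    · exact iSup_le fun a' => hF.hom_comp_graph_le hB.1 a a' b
    · exact le_iSup_of_le a (hgraph a b).ge
    · exact iSup_le fun a' => hF.cograph_comp_hom_le hB.1 a a' b
    · exact le_iSup_of_le a (hcograph a b).ge
end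

section
/- For any totally regular Q-semicategory B, the structure B_cc — whose objects are the left adjoint regular semidistributors φ : *_e ⇸ B in TRSDist(Q) for e ranging over the idempotent arrows of Q, with type t(φ : *_e ⇸ B) = dom(e), and hom-arrows B_cc(ψ,φ) = ψ*⊗φ — is a totally regular Q-semicategory. -/
open CategoryTheory

universe u

variable (Q : Type u) [SmallCategory Q] [∀ X Y : Q, CompleteLattice (X ⟶ Y)]

variable {Q}

/-- An object of the Cauchy completion of `B`: a left adjoint regular semidistributor
`φ : *_e ⇸ B` (for an idempotent `e : X ⟶ X` of `Q`) together with its right adjoint `ψ`. -/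
structure CCObj (B : QGraph Q) where
  X : Q
  e : X ⟶ X
  idem : e ≫ e = e
  φ : ∀ b : B.Obj, X ⟶ B.ty b
  ψ : ∀ b : B.Obj, B.ty b ⟶ X
  φ_regl : ∀ b', (⨆ b, φ b ≫ B.hom b b') = φ b'
  φ_regr : ∀ b, e ≫ φ b = φ b
  ψ_regl : ∀ b, ψ b ≫ e = ψ b
  ψ_regr : ∀ b', (⨆ b, B.hom b' b ≫ ψ b) = ψ b'
  unit : e ≤ ⨆ b, φ b ≫ ψ b
  counit : ∀ b b', ψ b ≫ φ b' ≤ B.hom b b'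

/-- The Cauchy completion `B_cc`; its hom-arrow from `p` to `q` is `B_cc(q,p) = q* ⊗ p`,
i.e. the lifting `[q,p]` in `TRSDist(Q)`. -/
def QGraph.cc (B : QGraph Q) : QGraph Q :=
  ⟨CCObj B, fun p => p.X, fun p q => ⨆ b, p.φ b ≫ q.ψ b⟩

/-- The object `k_B b`, i.e. the left adjoint `B(-,b) : *_{B(b,b)} ⇸ B` with right
adjoint `B(b,-)`. -/
def kObj {B : QGraph Q} (hB : B.IsTR) (b : B.Obj) : CCObj B where
  X := B.ty b
  e := B.hom b b
  idem := hB.2.1 b b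
  φ := fun y => B.hom b y
  ψ := fun y => B.hom y b
  φ_regl := fun b' =>
    le_antisymm (iSup_le fun y => hB.1 b y b') (le_iSup_of_le b (hB.2.1 b b').ge)
  φ_regr := fun y => hB.2.1 b y
  ψ_regl := fun y => hB.2.2 b y
  ψ_regr := fun b' =>
    le_antisymm (iSup_le fun y => hB.1 b' y b) (le_iSup_of_le b (hB.2.2 b b').ge)
  unit := le_iSup_of_le b (hB.2.1 b b).ge
  counit := fun y y' => hB.1 y b y'

/-- The Cauchy completion embedding `k_B : B → B_cc`. -/
def kMap {B : QGraph Q} (hB : B.IsTR) : ObjMap B (QGraph.cc B) :=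
  ⟨fun b => kObj hB b, fun _ => rfl⟩

namespace IsQuantaloid

variable [IsQuantaloid Q] {X Y Z : Q}

theorem comp_iSup {ι : Type*} (f : X ⟶ Y) (g : ι → (Y ⟶ Z)) :
    f ≫ (⨆ i, g i) = ⨆ i, f ≫ g i := by
  rw [iSup, comp_sSup, iSup_range]

theorem iSup_comp {ι : Type*} (f : ι → (X ⟶ Y)) (g : Y ⟶ Z) :
    (⨆ i, f i) ≫ g = ⨆ i, f i ≫ g := by
  rw [iSup, sSup_comp, iSup_range]

theorem comp_le_comp_left (f : X ⟶ Y) {g g' : Y ⟶ Z} (h : g ≤ g') : f ≫ g ≤ f ≫ g' := by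
  have key := comp_sSup f {g, g'}
  rw [sSup_pair, sup_eq_right.2 h, iSup_pair] at key
  exact key ▸ le_sup_left

theorem comp_le_comp_right {f f' : X ⟶ Y} (h : f ≤ f') (g : Y ⟶ Z) : f ≫ g ≤ f' ≫ g := by
  have key := sSup_comp {f, f'} g
  rw [sSup_pair, sup_eq_right.2 h, iSup_pair] at key
  exact key ▸ le_sup_left

end IsQuantaloid

namespace CCObj

open IsQuantaloid

variable [IsQuantaloid Q] {B : QGraph Q}

/-- The counit of `q` gives the composition inequality of `B_cc`. -/
theorem iSup_comp_iSup_le (p q r : CCObj B) :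
    (⨆ b, p.φ b ≫ q.ψ b) ≫ (⨆ b, q.φ b ≫ r.ψ b) ≤ ⨆ b, p.φ b ≫ r.ψ b := by
  rw [iSup_comp]
  refine iSup_le fun b => ?_
  rw [comp_iSup]
  refine iSup_le fun c => ?_
  calc (p.φ b ≫ q.ψ b) ≫ q.φ c ≫ r.ψ c
      = (p.φ b ≫ q.ψ b ≫ q.φ c) ≫ r.ψ c := by simp only [Category.assoc]
    _ ≤ (p.φ b ≫ B.hom b c) ≫ r.ψ c :=
        comp_le_comp_right (comp_le_comp_left _ (q.counit b c)) _
    _ ≤ p.φ c ≫ r.ψ c :=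
        comp_le_comp_right ((le_iSup (fun b => p.φ b ≫ B.hom b c) b).trans (p.φ_regl c).le) _
    _ ≤ ⨆ b, p.φ b ≫ r.ψ b := le_iSup (fun b => p.φ b ≫ r.ψ b) c

theorem e_comp_iSup (p q : CCObj B) :
    p.e ≫ (⨆ b, p.φ b ≫ q.ψ b) = ⨆ b, p.φ b ≫ q.ψ b := by
  simp only [comp_iSup, ← Category.assoc, p.φ_regr]

theorem iSup_comp_e (p q : CCObj B) :
    (⨆ b, p.φ b ≫ q.ψ b) ≫ q.e = ⨆ b, p.φ b ≫ q.ψ b := by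
  simp only [iSup_comp, Category.assoc, q.ψ_regl]

end CCObj

/-- the Cauchy completion `B_cc` of a totally regular `Q`-semicategory,
with objects the left adjoints `φ : *_e ⇸ B` and homs `B_cc(ψ,φ) = ψ*⊗φ`, is itself
a totally regular `Q`-semicategory. -/
theorem cc_isTR [IsQuantaloid Q] (B : QGraph Q) (hB : B.IsTR) :
    (QGraph.cc B).IsTR :=
  ⟨CCObj.iSup_comp_iSup_le,
    fun p q => le_antisymm (CCObj.iSup_comp_iSup_le p p q)
      ((CCObj.e_comp_iSup p q).ge.trans (IsQuantaloid.comp_le_comp_right p.unit _)),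
    fun p q => le_antisymm (CCObj.iSup_comp_iSup_le q p p)
      ((CCObj.iSup_comp_e q p).ge.trans (IsQuantaloid.comp_le_comp_left _ p.unit))⟩
end

section
/- For any totally regular Q-semicategory B, the map k_B : B → B_cc is a fully faithful regular semifunctor: it preserves types and satisfies B_cc(k_B b', k_B b) = B(b',b) for all b,b' ∈ B₀. -/
open CategoryTheory

universe u

variable (Q : Type u) [SmallCategory Q] [∀ X Y : Q, CompleteLattice (X ⟶ Y)]

variable {Q}

namespace QGraph

variable {B : QGraph Q}

/-- Yoneda: the hom-arrow of `B_cc` out of `k_B b` is the right adjoint evaluated at `b`. -/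
theorem cc_hom_kObj_left (hB : B.IsTR) (b : B.Obj) (q : CCObj B) :
    (QGraph.cc B).hom (kObj hB b) q = q.ψ b :=
  q.ψ_regr b

/-- Yoneda: the hom-arrow of `B_cc` into `k_B b` is the left adjoint evaluated at `b`. -/
theorem cc_hom_kObj_right (hB : B.IsTR) (p : CCObj B) (b : B.Obj) :
    (QGraph.cc B).hom p (kObj hB b) = p.φ b :=
  p.φ_regl b

theorem graph_kMap (hB : B.IsTR) (b : B.Obj) (q : CCObj B) :
    (kMap hB).graph b q = q.ψ b :=
  (Category.id_comp _).trans (cc_hom_kObj_left hB b q)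

theorem cograph_kMap (hB : B.IsTR) (p : CCObj B) (b : B.Obj) :
    (kMap hB).cograph p b = p.φ b :=
  (Category.comp_id _).trans (cc_hom_kObj_right hB p b)

theorem kMap_isFullyFaithful (hB : B.IsTR) : (kMap hB).IsFullyFaithful := fun b b' =>
  (((Category.id_comp _).trans (Category.comp_id _)).trans
    (cc_hom_kObj_left hB b (kObj hB b'))).symm

theorem kMap_isRSFun (hB : B.IsTR) : (kMap hB).IsRSFun :=
  ⟨fun b b' => (kMap_isFullyFaithful hB b b').le,
    fun b q => (iSup_congr fun b' => congrArg (B.hom b b' ≫ ·) (graph_kMap hB b' q)).trans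
      ((q.ψ_regr b).trans (graph_kMap hB b q).symm),
    fun b p => (iSup_congr fun b' => congrArg (· ≫ B.hom b' b) (cograph_kMap hB p b')).trans
      ((p.φ_regl b).trans (cograph_kMap hB p b).symm)⟩

end QGraph

/-- `k_B : B → B_cc` is a fully faithful regular semifunctor; it preserves
types and `B_cc(k_B b', k_B b) = B(b',b)`. -/
theorem kMap_fully_faithful_regular_semifunctor [IsQuantaloid Q]
    (B : QGraph Q) (hB : B.IsTR) :
    (∀ b : B.Obj, (QGraph.cc B).ty ((kMap hB).map b) = B.ty b) ∧
    (kMap hB).IsFullyFaithful ∧ (kMap hB).IsRSFun ∧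
    (∀ b b' : B.Obj, (QGraph.cc B).hom (kObj hB b) (kObj hB b') = B.hom b b') := by
  exact ⟨fun _ => rfl, QGraph.kMap_isFullyFaithful hB, QGraph.kMap_isRSFun hB,
    fun b b' => QGraph.cc_hom_kObj_left hB b (kObj hB b')⟩
end

section
/- For totally regular Q-semicategories A and B, the following are equivalent: (1) A and B are isomorphic objects of the quantaloid TRSDist(Q); (2) the Cauchy completions A_cc and B_cc are equivalent in the locally ordered category TRSCat(Q), i.e. there exist regular semifunctors F : A_cc → B_cc and G : B_cc → A_cc with G∘F ≅ 1_{A_cc} and F∘G ≅ 1_{B_cc}. -/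
open CategoryTheory

universe u

variable (Q : Type u) [SmallCategory Q] [∀ X Y : Q, CompleteLattice (X ⟶ Y)]

variable {Q}

section Quantaloid

variable [IsQuantaloid Q] {X Y Z : Q}

theorem quantaloid_comp_iSup {ι : Sort*} (f : X ⟶ Y) (g : ι → (Y ⟶ Z)) :
    f ≫ (⨆ i, g i) = ⨆ i, f ≫ g i := by
  rw [iSup, IsQuantaloid.comp_sSup, iSup_range]

theorem quantaloid_iSup_comp {ι : Sort*} (f : ι → (X ⟶ Y)) (g : Y ⟶ Z) :
    (⨆ i, f i) ≫ g = ⨆ i, f i ≫ g := by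
  rw [iSup, IsQuantaloid.sSup_comp, iSup_range]

theorem quantaloid_comp_le_comp {f f' : X ⟶ Y} {g g' : Y ⟶ Z} (hf : f ≤ f') (hg : g ≤ g') :
    f ≫ g ≤ f' ≫ g' := by
  have hl : f ≫ g ≤ f' ≫ g := by
    rw [← sup_eq_right.2 hf, ← sSup_pair, IsQuantaloid.sSup_comp]
    exact le_iSup₂_of_le f (by simp) le_rfl
  have hr : f' ≫ g ≤ f' ≫ g' := by
    rw [← sup_eq_right.2 hg, ← sSup_pair, IsQuantaloid.comp_sSup]
    exact le_iSup₂_of_le g (by simp) le_rfl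
  exact hl.trans hr

end Quantaloid

/-- The hom-arrows of `A`, viewed as a matrix from `A` to itself. -/
def QGraph.homMat (A : QGraph Q) : QMat A A :=
  A.hom

theorem isRSDist_iff {A B : QGraph Q} (Φ : QMat A B) :
    IsRSDist Φ ↔ matComp Φ B.homMat = Φ ∧ matComp A.homMat Φ = Φ :=
  ⟨fun h => ⟨funext fun a => funext (h.1 a), funext fun a => funext (h.2 a)⟩,
    fun h => ⟨fun a => congrFun (congrFun h.1 a), fun a => congrFun (congrFun h.2 a)⟩⟩

theorem QGraph.IsTR.homMat_comp_homMat {A : QGraph Q} (hA : A.IsTR) :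
    matComp A.homMat A.homMat = A.homMat := by
  funext a a'
  exact le_antisymm (iSup_le fun y => hA.1 a y a') (le_iSup_of_le a (hA.2.1 a a').ge)

section Matrices

variable [IsQuantaloid Q] {A B C D : QGraph Q}

theorem matComp_assoc (Φ : QMat A B) (Ψ : QMat B C) (Θ : QMat C D) :
    matComp (matComp Φ Ψ) Θ = matComp Φ (matComp Ψ Θ) := by
  funext a d
  simp only [matComp, quantaloid_comp_iSup, quantaloid_iSup_comp, Category.assoc]
  exact iSup_comm

theorem matComp_mono {Φ Φ' : QMat A B} {Ψ Ψ' : QMat B C} (hΦ : ∀ a b, Φ a b ≤ Φ' a b)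
    (hΨ : ∀ b c, Ψ b c ≤ Ψ' b c) (a : A.Obj) (c : C.Obj) :
    matComp Φ Ψ a c ≤ matComp Φ' Ψ' a c :=
  iSup_mono fun b => quantaloid_comp_le_comp (hΦ a b) (hΨ b c)

end Matrices

namespace CCObj

variable {A B C : QGraph Q}

/-- The left adjoint `*_e ⇸ B` underlying an object of the Cauchy completion. -/
def phi (p : CCObj B) : QMat (QGraph.single p.X p.e) B :=
  fun _ b => p.φ b

/-- The right adjoint `B ⇸ *_e` underlying an object of the Cauchy completion. -/
def psi (p : CCObj B) : QMat B (QGraph.single p.X p.e) :=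
  fun b _ => p.ψ b

theorem phi_comp_homMat (p : CCObj B) : matComp p.phi B.homMat = p.phi := by
  funext _ b
  exact p.φ_regl b

theorem homMat_comp_psi (p : CCObj B) : matComp B.homMat p.psi = p.psi := by
  funext b _
  exact p.ψ_regr b

theorem psi_comp_phi_le (p : CCObj B) (b b' : B.Obj) :
    matComp p.psi p.phi b b' ≤ B.homMat b b' :=
  iSup_le fun _ => p.counit b b'

variable [IsQuantaloid Q]

theorem pushforward_comp {Φ : QMat A B} {Ψ : QMat B A} (hΦΨ : matComp Φ Ψ = A.homMat)
    (p q : CCObj A) :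
    matComp (matComp p.phi Φ) (matComp Ψ q.psi) = matComp p.phi q.psi := by
  rw [matComp_assoc, ← matComp_assoc Φ, hΦΨ, q.homMat_comp_psi]

/-- Transport of an object of `A_cc` along an isomorphism `Φ : A ⇸ B` with inverse `Ψ`. -/
def pushforward (Φ : QMat A B) (Ψ : QMat B A) (hΦ : IsRSDist Φ) (hΨ : IsRSDist Ψ)
    (hΦΨ : matComp Φ Ψ = A.homMat) (hΨΦ : matComp Ψ Φ = B.homMat) (p : CCObj A) :
    CCObj B where
  X := p.X
  e := p.e
  idem := p.idem
  φ := matComp p.phi Φ PUnit.unit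
  ψ := fun b => matComp Ψ p.psi b PUnit.unit
  φ_regl := congrFun <| congrFun (show matComp (matComp p.phi Φ) B.homMat = matComp p.phi Φ by
    rw [matComp_assoc, ((isRSDist_iff Φ).1 hΦ).1]) PUnit.unit
  φ_regr := fun b => by
    have h : p.e ≫ (⨆ a, p.φ a ≫ Φ a b) = ⨆ a, p.φ a ≫ Φ a b := by
      simp only [quantaloid_comp_iSup, ← Category.assoc, p.φ_regr]
    exact h
  ψ_regl := fun b => by
    have h : (⨆ a, Ψ b a ≫ p.ψ a) ≫ p.e = ⨆ a, Ψ b a ≫ p.ψ a := by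
      simp only [quantaloid_iSup_comp, Category.assoc, p.ψ_regl]
    exact h
  ψ_regr := fun b => congrFun (congrFun (show matComp B.homMat (matComp Ψ p.psi) = matComp Ψ p.psi
    by rw [← matComp_assoc, ((isRSDist_iff Ψ).1 hΨ).2]) b) PUnit.unit
  unit := p.unit.trans
    (congrFun (congrFun (pushforward_comp hΦΨ p p) PUnit.unit) PUnit.unit).ge
  counit := fun b b' => by
    have h : matComp (matComp Ψ p.psi) (matComp p.phi Φ) b b' ≤ B.hom b b' := by
      rw [matComp_assoc, ← matComp_assoc p.psi]
      refine (matComp_mono (fun _ _ => le_rfl)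
        (matComp_mono p.psi_comp_phi_le fun _ _ => le_rfl) b b').trans ?_
      rw [((isRSDist_iff Φ).1 hΦ).2, hΨΦ]
      exact le_rfl
    exact (le_iSup (fun u => matComp Ψ p.psi b u ≫ matComp p.phi Φ u b') PUnit.unit).trans h

end CCObj

section Evaluation

variable {B : QGraph Q}

/-- Evaluation of right adjoints: the matrix `B_cc(-,k_B-)` from `B` to `B_cc`. -/
def toCC (B : QGraph Q) : QMat B B.cc :=
  fun b p => p.ψ b

/-- Evaluation of left adjoints: the matrix `B_cc(k_B-,-)` from `B_cc` to `B`. -/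
def fromCC (B : QGraph Q) : QMat B.cc B :=
  fun p b => p.φ b

theorem fromCC_comp_toCC (B : QGraph Q) : matComp (fromCC B) (toCC B) = B.cc.homMat :=
  rfl

theorem QGraph.IsTR.toCC_comp_fromCC (hB : B.IsTR) :
    matComp (toCC B) (fromCC B) = B.homMat := by
  funext b b'
  exact le_antisymm (iSup_le fun p => p.counit b b')
    (le_iSup_of_le (f := fun p : CCObj B => p.ψ b ≫ p.φ b') (kObj hB b) (hB.2.1 b b').ge)

theorem homMat_comp_toCC (B : QGraph Q) : matComp B.homMat (toCC B) = toCC B := by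
  funext b p
  exact p.ψ_regr b

theorem fromCC_comp_homMat (B : QGraph Q) : matComp (fromCC B) B.homMat = fromCC B := by
  funext p b
  exact p.φ_regl b

end Evaluation

section CauchyCompletion

variable [IsQuantaloid Q] {B : QGraph Q}

theorem QGraph.cc_isTR (B : QGraph Q) : B.cc.IsTR := by
  have hsemi : B.cc.IsSemiCat := fun p q r => by
    have h : matComp (matComp p.phi q.psi) (matComp q.phi r.psi) PUnit.unit PUnit.unit ≤
        matComp p.phi r.psi PUnit.unit PUnit.unit := by
      rw [matComp_assoc, ← matComp_assoc q.psi]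
      refine (matComp_mono (fun _ _ => le_rfl)
        (matComp_mono q.psi_comp_phi_le fun _ _ => le_rfl) _ _).trans ?_
      rw [r.homMat_comp_psi]
    exact (le_iSup (fun u => matComp p.phi q.psi PUnit.unit u ≫
      matComp q.phi r.psi u PUnit.unit) PUnit.unit).trans h
  refine ⟨hsemi, fun p q => le_antisymm (hsemi p p q) ?_,
    fun p q => le_antisymm (hsemi q p p) ?_⟩
  · have h : B.cc.hom p q = p.e ≫ B.cc.hom p q := by
      simp only [QGraph.cc, quantaloid_comp_iSup, ← Category.assoc, p.φ_regr]
    exact h.le.trans (quantaloid_comp_le_comp p.unit le_rfl)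
  · have h : B.cc.hom q p = B.cc.hom q p ≫ p.e := by
      simp only [QGraph.cc, quantaloid_iSup_comp, Category.assoc, p.ψ_regl]
    exact h.le.trans (quantaloid_comp_le_comp le_rfl p.unit)

theorem QGraph.IsTR.toCC_comp_homMat (hB : B.IsTR) :
    matComp (toCC B) B.cc.homMat = toCC B := by
  rw [← fromCC_comp_toCC, ← matComp_assoc, hB.toCC_comp_fromCC, homMat_comp_toCC]

end CauchyCompletion

namespace ObjMap

variable [IsQuantaloid Q] {A B C : QGraph Q}

theorem graph_comp_homMat (F : ObjMap A B) (hB : B.IsTR) :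
    matComp F.graph B.homMat = F.graph := by
  funext a b
  have h := congrFun (congrFun hB.homMat_comp_homMat (F.map a)) b
  simp only [matComp, QGraph.homMat] at h
  simp only [matComp, graph, QGraph.homMat, Category.assoc, ← quantaloid_comp_iSup, h]

theorem IsRSFun.graph_comp_graph (F : ObjMap A B) {G : ObjMap B C} (hG : G.IsRSFun) :
    matComp F.graph G.graph = (F.comp G).graph := by
  funext a c
  change (⨆ b, (eqToHom (F.ty_eq a).symm ≫ B.hom (F.map a) b) ≫ G.graph b c) = _
  simp only [Category.assoc, ← quantaloid_comp_iSup, hG.2.1]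
  simp [graph, comp]

/-- A fully faithful map into a totally regular semicategory is a regular semifunctor. -/
theorem IsFullyFaithful.isRSFun (hB : B.IsTR) {F : ObjMap A B} (hF : F.IsFullyFaithful) : F.IsRSFun := by
  refine ⟨fun a a' => (hF a a').le, fun a b => le_antisymm (iSup_le fun a' => ?_) ?_,
    fun a b => le_antisymm (iSup_le fun a' => ?_) ?_⟩
  · rw [hF a a']
    simp only [graph, Category.assoc, eqToHom_trans_assoc, eqToHom_refl, Category.id_comp]
    exact quantaloid_comp_le_comp le_rfl (hB.1 _ _ _)
  · refine le_iSup_of_le a ?_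
    rw [hF a a]
    simp only [graph, Category.assoc, eqToHom_trans_assoc, eqToHom_refl, Category.id_comp,
      hB.2.1, le_refl]
  · rw [hF a' a]
    simp only [cograph, Category.assoc, eqToHom_trans_assoc, eqToHom_refl, Category.id_comp]
    rw [← Category.assoc]
    exact quantaloid_comp_le_comp (hB.1 _ _ _) le_rfl
  · refine le_iSup_of_le a ?_
    rw [hF a a]
    simp only [cograph, Category.assoc, eqToHom_trans_assoc, eqToHom_refl, Category.id_comp]
    rw [← Category.assoc (B.hom _ _), hB.2.2]

end ObjMap

section Equivalence

variable [IsQuantaloid Q] {A B : QGraph Q}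

/-- The object map `A_cc → B_cc` induced by an isomorphism `Φ : A ⇸ B` with inverse `Ψ`. -/
def ccMap (Φ : QMat A B) (Ψ : QMat B A) (hΦ : IsRSDist Φ) (hΨ : IsRSDist Ψ)
    (hΦΨ : matComp Φ Ψ = A.homMat) (hΨΦ : matComp Ψ Φ = B.homMat) : ObjMap A.cc B.cc :=
  ⟨CCObj.pushforward Φ Ψ hΦ hΨ hΦΨ hΨΦ, fun _ => rfl⟩

theorem ccMap_isRSFun (Φ : QMat A B) (Ψ : QMat B A) (hΦ : IsRSDist Φ) (hΨ : IsRSDist Ψ)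
    (hΦΨ : matComp Φ Ψ = A.homMat) (hΨΦ : matComp Ψ Φ = B.homMat) :
    (ccMap Φ Ψ hΦ hΨ hΦΨ hΨΦ).IsRSFun := by
  refine ObjMap.IsFullyFaithful.isRSFun B.cc_isTR fun p q => ?_
  refine Eq.trans ?_ ((Category.id_comp _).trans (Category.comp_id _)).symm
  exact (congrFun (congrFun (CCObj.pushforward_comp hΦΨ p q) PUnit.unit) PUnit.unit).symm

theorem ccMap_comp_graph (Φ : QMat A B) (Ψ : QMat B A) (hΦ : IsRSDist Φ) (hΨ : IsRSDist Ψ)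
    (hΦΨ : matComp Φ Ψ = A.homMat) (hΨΦ : matComp Ψ Φ = B.homMat) (p p' : CCObj A) :
    ((ccMap Φ Ψ hΦ hΨ hΦΨ hΨΦ).comp (ccMap Ψ Φ hΨ hΦ hΨΦ hΦΨ)).graph p p' =
      A.cc.hom p p' := by
  have h : matComp (matComp (matComp p.phi Φ) Ψ) p'.psi = matComp p.phi p'.psi := by
    rw [matComp_assoc p.phi, hΦΨ, p.phi_comp_homMat]
  refine (Category.id_comp _).trans ?_
  exact congrFun (congrFun h PUnit.unit) PUnit.unit

/-- The regular semidistributor `A ⇸ B` corresponding to an object map `A_cc → B_cc`. -/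
def ObjMap.ccRestrict (F : ObjMap A.cc B.cc) : QMat A B :=
  matComp (toCC A) (matComp F.graph (fromCC B))

theorem ObjMap.isRSDist_ccRestrict (F : ObjMap A.cc B.cc) : IsRSDist F.ccRestrict := by
  rw [isRSDist_iff, ccRestrict, matComp_assoc, matComp_assoc, fromCC_comp_homMat,
    ← matComp_assoc A.homMat, homMat_comp_toCC]
  exact ⟨rfl, rfl⟩

theorem ObjMap.ccRestrict_comp_ccRestrict (hA : A.IsTR) (F : ObjMap A.cc B.cc)
    (G : ObjMap B.cc A.cc) (hG : G.IsRSFun)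
    (hFG : ∀ p p', (F.comp G).graph p p' = A.cc.hom p p') :
    matComp F.ccRestrict G.ccRestrict = A.homMat := by
  have hFG' : matComp F.graph G.graph = A.cc.homMat := by
    rw [hG.graph_comp_graph]
    funext p p'
    exact hFG p p'
  calc matComp F.ccRestrict G.ccRestrict
      = matComp (toCC A) (matComp (matComp (matComp F.graph
          (matComp (fromCC B) (toCC B))) G.graph) (fromCC A)) := by
        simp only [ccRestrict, matComp_assoc]
    _ = A.homMat := by
        rw [fromCC_comp_toCC, F.graph_comp_homMat B.cc_isTR, hFG', ← matComp_assoc,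
          hA.toCC_comp_homMat, hA.toCC_comp_fromCC]

end Equivalence

/-- Morita equivalence: totally regular `Q`-semicategories are isomorphic
in `TRSDist(Q)` iff their Cauchy completions are equivalent in `TRSCat(Q)`. -/
theorem morita_iff_cc_equivalent [IsQuantaloid Q]
    (A B : QGraph Q) (hA : A.IsTR) (hB : B.IsTR) :
    (∃ (Φ : QMat A B) (Ψ : QMat B A), IsRSDist Φ ∧ IsRSDist Ψ ∧
      (∀ a a', matComp Φ Ψ a a' = A.hom a a') ∧
      (∀ b b', matComp Ψ Φ b b' = B.hom b b')) ↔
    (∃ (F : ObjMap (QGraph.cc A) (QGraph.cc B)) (G : ObjMap (QGraph.cc B) (QGraph.cc A)),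
      F.IsRSFun ∧ G.IsRSFun ∧
      (∀ p p', (F.comp G).graph p p' = (QGraph.cc A).hom p p') ∧
      (∀ q q', (G.comp F).graph q q' = (QGraph.cc B).hom q q')) := by
  constructor
  · rintro ⟨Φ, Ψ, hΦ, hΨ, h₁, h₂⟩
    have hΦΨ : matComp Φ Ψ = A.homMat := funext fun a => funext (h₁ a)
    have hΨΦ : matComp Ψ Φ = B.homMat := funext fun b => funext (h₂ b)
    exact ⟨ccMap Φ Ψ hΦ hΨ hΦΨ hΨΦ, ccMap Ψ Φ hΨ hΦ hΨΦ hΦΨ,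
      ccMap_isRSFun Φ Ψ hΦ hΨ hΦΨ hΨΦ, ccMap_isRSFun Ψ Φ hΨ hΦ hΨΦ hΦΨ,
      ccMap_comp_graph Φ Ψ hΦ hΨ hΦΨ hΨΦ, ccMap_comp_graph Ψ Φ hΨ hΦ hΨΦ hΦΨ⟩
  · rintro ⟨F, G, hF, hG, hFG, hGF⟩
    refine ⟨F.ccRestrict, G.ccRestrict, F.isRSDist_ccRestrict, G.isRSDist_ccRestrict,
      fun a a' => ?_, fun b b' => ?_⟩
    · rw [ObjMap.ccRestrict_comp_ccRestrict hA F G hG hFG]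
      rfl
    · rw [ObjMap.ccRestrict_comp_ccRestrict hB G F hF hGF]
      rfl
end
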